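/- arXiv:0712.2661 — 9 statements merged into one kernel-verified Lean document; each statement's English description precedes it below -/
import Mathlib

section
/- Let D be an acyclic digraph and let S be a nonempty set of vertices of D. Then there exists an S-path in D if and only if there exists an S-path in the transitive closure D^TC of D. -/
variable {V : Type*}

/-- A digraph (given by its arc relation) is acyclic if it has no directed cycle. -/
def DigraphAcyclic (A : V → V → Prop) : Prop :=
  ∀ v : V, ¬ Relation.TransGen A v v

/-- `IsPathFromTo A u p w` states that `u :: (p ++ [w])` is a directed path
from `u` to `w` in the digraph with arc relation `A`, whose internal vertices
are listed (in order) by `p`. -/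
def IsPathFromTo (A : V → V → Prop) (u : V) (p : List V) (w : V) : Prop :=
  List.Chain A u (p ++ [w]) ∧ (u :: (p ++ [w])).Nodup

/-- A set `S` of vertices is convex if it is nonempty and no directed path between
vertices of `S` contains a vertex not in `S`. -/
def DigraphConvex (A : V → V → Prop) (S : Set V) : Prop :=
  S.Nonempty ∧ ∀ (u w : V) (p : List V), u ∈ S → w ∈ S → IsPathFromTo A u p w →
    ∀ x ∈ p, x ∈ S

/-- A set `S` of vertices is connected if it is nonempty and the underlying undirected
graph of the subdigraph induced by `S` is connected. -/
def DigraphConnectedSet (A : V → V → Prop) (S : Set V) : Prop :=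
  S.Nonempty ∧ ∀ x ∈ S, ∀ y ∈ S,
    Relation.ReflTransGen (fun a b => a ∈ S ∧ b ∈ S ∧ (A a b ∨ A b a)) x y

/-- A cc-set: a set that is both connected and convex. -/
def DigraphCC (A : V → V → Prop) (S : Set V) : Prop :=
  DigraphConnectedSet A S ∧ DigraphConvex A S

/-- A digraph is connected if its underlying undirected graph is connected. -/
def DigraphConnected (A : V → V → Prop) : Prop :=
  ∀ x y : V, Relation.ReflTransGen (fun a b => A a b ∨ A b a) x y

/-- There is an `S`-path: a directed path with at least three vertices whose endpoints
are in `S` and whose internal vertices are not in `S`. -/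
def HasSPath (A : V → V → Prop) (S : Set V) : Prop :=
  ∃ (u w : V) (p : List V), u ∈ S ∧ w ∈ S ∧ p ≠ [] ∧ (∀ x ∈ p, x ∉ S) ∧
    IsPathFromTo A u p w

/-- `s` is a source of the subdigraph induced by `S`. -/
def IsSourceIn (A : V → V → Prop) (S : Set V) (s : V) : Prop :=
  ∀ y ∈ S, ¬ A y s

/-- `s` is a sink of the subdigraph induced by `S`. -/
def IsSinkIn (A : V → V → Prop) (S : Set V) (s : V) : Prop :=
  ∀ y ∈ S, ¬ A s y

theorem IsPathFromTo.of_isChain {V : Type*} {A : V → V → Prop} (hA : DigraphAcyclic A)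
    {u w : V} {p : List V} (h : List.IsChain A (u :: (p ++ [w]))) : IsPathFromTo A u p w := by
  refine ⟨h, ?_⟩
  have hp : List.Pairwise (Relation.TransGen A) (u :: (p ++ [w])) :=
    (h.imp fun _ _ hab => Relation.TransGen.single hab).pairwise
  refine hp.imp ?_
  rintro a _ hab rfl
  exact hA a hab

/-- A walk from `x ∉ S` to a vertex of `S` can be cut at its first vertex in `S`. -/
theorem exists_isChain_to_of_transGen {V : Type*} {A : V → V → Prop} {S : Set V} {x w : V}
    (hw : w ∈ S) (h : Relation.TransGen A x w) :
    ∃ w' ∈ S, ∃ r : List V, (∀ y ∈ r, y ∉ S) ∧ List.IsChain A (x :: (r ++ [w'])) := by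
  induction h using Relation.TransGen.head_induction_on with
  | single hxw => exact ⟨w, hw, [], by simp, by simpa using hxw⟩
  | @head a b hab _ ih =>
    by_cases hb : b ∈ S
    · exact ⟨b, hb, [], by simp, by simpa using hab⟩
    · obtain ⟨w', hw', r, hr, hc⟩ := ih
      exact ⟨w', hw', b :: r, by simpa using ⟨hb, hr⟩, List.IsChain.cons_cons hab hc⟩

/-- A walk leaving `x ∉ S` into `S`, internally outside `S`, extends backwards to an `S`-path
as soon as `x` is reachable from `S`. -/
theorem HasSPath.of_transGen_of_isChain {V : Type*} {A : V → V → Prop} {S : Set V}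
    (hA : DigraphAcyclic A) {u x w : V} (hu : u ∈ S) (hw : w ∈ S)
    (h : Relation.TransGen A u x) (hx : x ∉ S) {r : List V} (hr : ∀ y ∈ r, y ∉ S)
    (hc : List.IsChain A (x :: (r ++ [w]))) : HasSPath A S := by
  induction h generalizing r with
  | @single x hux =>
    exact ⟨u, w, x :: r, hu, hw, by simp, by simpa using ⟨hx, hr⟩,
      .of_isChain hA (List.IsChain.cons_cons hux hc)⟩
  | @tail b x _ hbx ih =>
    have hxr : ∀ y ∈ x :: r, y ∉ S := by simpa using ⟨hx, hr⟩
    have hbc : List.IsChain A (b :: ((x :: r) ++ [w])) := List.IsChain.cons_cons hbx hc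
    by_cases hb : b ∈ S
    · exact ⟨b, w, x :: r, hb, hw, by simp, hxr, .of_isChain hA hbc⟩
    · exact ih hb hxr hbc

/-- Let D be an acyclic digraph and S a nonempty set of vertices of D.
There is an S-path in D iff there is an S-path in the transitive closure of D. -/
theorem sPath_iff_sPath_transClosure {V : Type*} (A : V → V → Prop) (S : Set V)
    (hA : DigraphAcyclic A) (hS : S.Nonempty) :
    HasSPath A S ↔ HasSPath (fun x y => Relation.TransGen A x y) S := by
  constructor
  · rintro ⟨u, w, p, hu, hw, hp, hpS, hc, hn⟩
    exact ⟨u, w, p, hu, hw, hp, hpS,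
      List.IsChain.imp (fun _ _ hab => Relation.TransGen.single hab) hc, hn⟩
  · rintro ⟨u, w, p, hu, hw, hp, hpS, hc, -⟩
    obtain ⟨x, q, rfl⟩ := List.exists_cons_of_ne_nil hp
    have hpw : List.Pairwise (Relation.TransGen A) (u :: x :: (q ++ [w])) :=
      List.IsChain.pairwise hc
    rw [List.pairwise_cons, List.pairwise_cons] at hpw
    obtain ⟨w', hw', r, hr, hrc⟩ :=
      exists_isChain_to_of_transGen hw (hpw.2.1 w (by simp))
    exact .of_transGen_of_isChain hA hu hw' (hpw.1 x (by simp)) (hpS x (by simp)) hr hrc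
end

section
/- Let D be a connected acyclic digraph and let S be a set of vertices of D. Then S is a connected convex set of D if and only if S is a connected convex set of the transitive closure D^TC of D. -/
variable {V : Type*}

theorem Relation.TransGen.exists_isChain_cons_append_singleton {α : Type*} {r : α → α → Prop}
    {a b : α} (h : Relation.TransGen r a b) : ∃ l : List α, List.IsChain r (a :: (l ++ [b])) := by
  induction h using Relation.TransGen.head_induction_on with
  | single h => exact ⟨[], by simpa using h⟩
  | head h _ ih =>
    obtain ⟨l, hl⟩ := ih
    exact ⟨_ :: l, List.IsChain.cons_cons h hl⟩

theorem List.IsChain.pairwise_transGen {α : Type*} {r : α → α → Prop} {l : List α}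
    (h : l.IsChain r) : l.Pairwise (Relation.TransGen r) :=
  (h.imp fun _ _ => Relation.TransGen.single).pairwise

theorem DigraphAcyclic.nodup_of_isChain {α : Type*} {A : α → α → Prop} (hA : DigraphAcyclic A)
    {l : List α} (h : l.IsChain A) : l.Nodup :=
  h.pairwise_transGen.imp fun {a _} hab => by rintro rfl; exact hA a hab

theorem DigraphAcyclic.transGen {α : Type*} {A : α → α → Prop} (hA : DigraphAcyclic A) :
    DigraphAcyclic (Relation.TransGen A) := fun v h =>
  hA v (by rwa [Relation.transGen_eq_self] at h)

theorem DigraphAcyclic.isPathFromTo_iff {α : Type*} {A : α → α → Prop} (hA : DigraphAcyclic A)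
    {u w : α} {p : List α} : IsPathFromTo A u p w ↔ List.IsChain A (u :: (p ++ [w])) :=
  ⟨fun h => h.1, fun h => ⟨h, hA.nodup_of_isChain h⟩⟩

/-- In an acyclic digraph, convexity is closure under betweenness for reachability. -/
theorem DigraphAcyclic.digraphConvex_iff {α : Type*} {A : α → α → Prop} (hA : DigraphAcyclic A)
    {S : Set α} : DigraphConvex A S ↔ S.Nonempty ∧ ∀ u x w, u ∈ S → w ∈ S →
      Relation.TransGen A u x → Relation.TransGen A x w → x ∈ S := by
  refine and_congr_right fun _ => ⟨fun h u x w hu hw hux hxw => ?_, fun h u w p hu hw hp x hx => ?_⟩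
  · obtain ⟨p, hp⟩ := hux.exists_isChain_cons_append_singleton
    obtain ⟨q, hq⟩ := hxw.exists_isChain_cons_append_singleton
    refine h u w (p ++ x :: q) hu hw (hA.isPathFromTo_iff.2 ?_) x (by simp)
    simpa using List.isChain_cons_split.2 ⟨hp, hq⟩
  · have hpw := (hA.isPathFromTo_iff.1 hp).pairwise_transGen
    rw [List.pairwise_cons, List.pairwise_append] at hpw
    exact h u x w hu hw (hpw.1 x (by simp [hx])) (hpw.2.2.2 x hx w (by simp))

theorem DigraphAcyclic.digraphConvex_transGen_iff {α : Type*} {A : α → α → Prop}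
    (hA : DigraphAcyclic A) {S : Set α} :
    DigraphConvex (Relation.TransGen A) S ↔ DigraphConvex A S := by
  rw [hA.transGen.digraphConvex_iff, hA.digraphConvex_iff, Relation.transGen_eq_self]

/-- Vertices of a convex set joined by a directed path are joined inside the set. -/
theorem DigraphAcyclic.reflTransGen_of_transGen {α : Type*} {A : α → α → Prop}
    (hA : DigraphAcyclic A) {S : Set α} (hS : DigraphConvex A S) {a b : α} (ha : a ∈ S)
    (hb : b ∈ S) (h : Relation.TransGen A a b) :
    Relation.ReflTransGen (fun a b => a ∈ S ∧ b ∈ S ∧ A a b) a b := by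
  induction h using Relation.TransGen.head_induction_on with
  | single h => exact .single ⟨ha, hb, h⟩
  | head h hcb ih =>
    have hc := (hA.digraphConvex_iff.1 hS).2 _ _ _ ha hb (.single h) hcb
    exact .head ⟨ha, hc, h⟩ (ih hc)

theorem DigraphAcyclic.digraphConnectedSet_transGen_iff {α : Type*} {A : α → α → Prop}
    (hA : DigraphAcyclic A) {S : Set α} (hS : DigraphConvex A S) :
    DigraphConnectedSet (Relation.TransGen A) S ↔ DigraphConnectedSet A S := by
  refine and_congr_right fun _ => forall₄_congr fun x _ y _ => ⟨fun h => ?_, fun h => ?_⟩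
  · refine Relation.reflTransGen_closed (fun a b hab => ?_) _ _ h
    obtain ⟨ha, hb, hab | hba⟩ := hab
    · exact Relation.ReflTransGen.mono (fun _ _ h => ⟨h.1, h.2.1, .inl h.2.2⟩) _ _
        (hA.reflTransGen_of_transGen hS ha hb hab)
    · exact Relation.ReflTransGen.mono (fun _ _ h => ⟨h.2.1, h.1, .inr h.2.2⟩) _ _
        (Relation.reflTransGen_swap.2 (hA.reflTransGen_of_transGen hS hb ha hba))
  · exact Relation.ReflTransGen.mono (fun _ _ h => ⟨h.1, h.2.1, h.2.2.imp .single .single⟩) _ _ h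

/-- For a connected acyclic digraph D, a set S is a cc-set of D iff it is a
cc-set of the transitive closure of D. -/
theorem cc_iff_cc_transClosure {V : Type*} (A : V → V → Prop) (S : Set V)
    (hA : DigraphAcyclic A) (hconn : DigraphConnected A) :
    DigraphCC A S ↔ DigraphCC (fun x y => Relation.TransGen A x y) S := by
  unfold DigraphCC
  rw [hA.digraphConvex_transGen_iff]
  exact and_congr_left fun hS => (hA.digraphConnectedSet_transGen_iff hS).symm
end

section
/- For every connected acyclic digraph D of order n, the number cc(D) of connected convex sets of D satisfies cc(D) ≥ n(n+1)/2. -/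
variable {V : Type*}

section Helpers

open Relation

theorem DigraphConnectedSet.of_forall_reach {A : V → V → Prop} {S : Set V} {c : V} (hc : c ∈ S)
    (h : ∀ x ∈ S, ReflTransGen (fun a b => a ∈ S ∧ b ∈ S ∧ (A a b ∨ A b a)) x c) :
    DigraphConnectedSet A S := by
  refine ⟨⟨c, hc⟩, fun x hx y hy => (h x hx).trans ?_⟩
  have : Std.Symm fun a b => a ∈ S ∧ b ∈ S ∧ (A a b ∨ A b a) :=
    ⟨fun a b hab => ⟨hab.2.1, hab.1, hab.2.2.symm⟩⟩
  exact ReflTransGen.stdSymm.symm _ _ (h y hy)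

theorem digraphConnectedSet_singleton (A : V → V → Prop) (s : V) :
    DigraphConnectedSet A {s} :=
  .of_forall_reach rfl fun x hx => by rw [Set.mem_singleton_iff.1 hx]

theorem DigraphConnectedSet.insert {A : V → V → Prop} {C : Set V} {c y : V}
    (hC : DigraphConnectedSet A C) (hc : c ∈ C) (hcy : A c y ∨ A y c) :
    DigraphConnectedSet A (insert y C) := by
  refine .of_forall_reach (Set.mem_insert_of_mem y hc) fun x hx => ?_
  rcases hx with rfl | hx
  · exact .single ⟨Set.mem_insert _ _, Set.mem_insert_of_mem _ hc, hcy.symm⟩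
  · exact (hC.2 x hx c hc).lift id fun a b hab => ⟨Set.mem_insert_of_mem _ hab.1,
      Set.mem_insert_of_mem _ hab.2.1, hab.2.2⟩

/-- A proper nonempty subset of a connected set is joined to its complement by an arc. -/
theorem DigraphConnectedSet.exists_boundary {A : V → V → Prop} {S C : Set V} {s y : V}
    (hS : DigraphConnectedSet A S) (hCS : C ⊆ S) (hs : s ∈ C) (hy : y ∈ S) (hyC : y ∉ C) :
    ∃ c ∈ C, ∃ z ∈ S, z ∉ C ∧ (A c z ∨ A z c) := by
  by_contra! hcon
  apply hyC
  induction hS.2 s (hCS hs) y hy with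
  | refl => exact hs
  | tail _ hab ih =>
    by_contra hb
    have := hcon _ (by_contra fun ha => ha (ih hab.1 ha)) _ hab.2.1 hb
    exact hab.2.2.elim this.1 this.2

theorem DigraphAcyclic.flip {A : V → V → Prop} (hA : DigraphAcyclic A) :
    DigraphAcyclic (flip A) := fun v hv => hA v (transGen_swap.1 hv)

theorem DigraphAcyclic.exists_isSourceIn [Finite V] {A : V → V → Prop} (hA : DigraphAcyclic A)
    {S : Set V} (hS : S.Nonempty) : ∃ r ∈ S, IsSourceIn A S r := by
  have : Std.Irrefl (TransGen A) := ⟨hA⟩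
  obtain ⟨r, hr, h⟩ := (Finite.wellFounded_of_trans_of_irrefl (TransGen A)).has_min S hS
  exact ⟨r, hr, fun y hy hyr => h y hy (.single hyr)⟩

theorem DigraphAcyclic.exists_isSinkIn [Finite V] {A : V → V → Prop} (hA : DigraphAcyclic A)
    {S : Set V} (hS : S.Nonempty) : ∃ r ∈ S, IsSinkIn A S r :=
  hA.flip.exists_isSourceIn hS

/-- Besides a source or sink `t`, a larger set has another source or sink. -/
theorem DigraphAcyclic.exists_ne_source_or_sink [Finite V] {A : V → V → Prop}
    (hA : DigraphAcyclic A) {W : Set V} {t x : V} (hx : x ∈ W) (hxt : x ≠ t)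
    (ht : IsSourceIn A W t ∨ IsSinkIn A W t) :
    ∃ r ∈ W, r ≠ t ∧ (IsSourceIn A W r ∨ IsSinkIn A W r) := by
  have hne : (W \ {t}).Nonempty := ⟨x, hx, hxt⟩
  rcases ht with ht | ht
  · obtain ⟨r, hr, h⟩ := hA.exists_isSinkIn hne
    refine ⟨r, hr.1, hr.2, .inr fun y hy hry => ?_⟩
    by_cases hyt : y = t
    · exact ht r hr.1 (hyt ▸ hry)
    · exact h y ⟨hy, hyt⟩ hry
  · obtain ⟨r, hr, h⟩ := hA.exists_isSourceIn hne
    refine ⟨r, hr.1, hr.2, .inl fun y hy hry => ?_⟩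
    by_cases hyt : y = t
    · exact ht r hr.1 (hyt ▸ hry)
    · exact h y ⟨hy, hyt⟩ hry

/-- A connected set with at least two vertices has, besides any given vertex `s`, a source or
sink whose removal leaves it connected. -/
theorem DigraphConnectedSet.exists_removable [Finite V] {A : V → V → Prop}
    (hA : DigraphAcyclic A) {S : Set V} (hS : DigraphConnectedSet A S) {s x : V} (hs : s ∈ S)
    (hx : x ∈ S) (hxs : x ≠ s) :
    ∃ t ∈ S, t ≠ s ∧ (IsSourceIn A S t ∨ IsSinkIn A S t) ∧
      DigraphConnectedSet A (S \ {t}) := by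
  let P : Set (Set V) := {C | s ∈ C ∧ C ⊆ S ∧ DigraphConnectedSet A C ∧
    ∃ t ∈ S, t ∉ C ∧ (IsSourceIn A S t ∨ IsSinkIn A S t)}
  have hP : P.Nonempty := by
    refine ⟨{s}, rfl, by simpa using hs, digraphConnectedSet_singleton A s, ?_⟩
    obtain ⟨r, hr, hsrc⟩ := hA.exists_isSourceIn hS.1
    by_cases hrs : r = s
    · subst hrs
      exact hA.exists_ne_source_or_sink hx hxs (.inl hsrc)
    · exact ⟨r, hr, hrs, .inl hsrc⟩
  obtain ⟨C, ⟨hsC, hCS, hC, t, htS, htC, ht⟩, hmax⟩ := P.toFinite.exists_maximal hP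
  have key : ∀ c ∈ C, ∀ y ∈ S, y ∉ C → (A c y ∨ A y c) → ∀ r ∈ S, r ∉ C → r ≠ y →
      ¬ (IsSourceIn A S r ∨ IsSinkIn A S r) := fun c hc y hy hyC hcy r hr hrC hry hrS =>
    hyC (hmax ⟨Set.mem_insert_of_mem y hsC, Set.insert_subset hy hCS, hC.insert hc hcy,
      r, hr, by simp [hry, hrC], hrS⟩ (Set.subset_insert y C) (Set.mem_insert y C))
  have hadj : ∀ c ∈ C, ∀ y ∈ S, y ∉ C → (A c y ∨ A y c) → y = t := fun c hc y hy hyC hcy =>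
    by_contra fun hyt => key c hc y hy hyC hcy t htS htC (Ne.symm hyt) ht
  have hCt : S \ {t} = C := by
    refine Set.Subset.antisymm (fun z hz => ?_) fun z hz =>
      ⟨hCS hz, fun h => htC (Set.mem_singleton_iff.1 h ▸ hz)⟩
    by_contra hzC
    obtain ⟨r, hr, hrt, hrW⟩ := hA.exists_ne_source_or_sink (W := S \ C) ⟨hz.1, hzC⟩ hz.2
      (ht.imp (fun h y hy => h y hy.1) fun h y hy => h y hy.1)
    obtain ⟨c, hc, y, hy, hyC, hcy⟩ := hS.exists_boundary hCS hsC htS htC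
    obtain rfl := hadj c hc y hy hyC hcy
    refine key c hc y hy hyC hcy r hr.1 hr.2 hrt (hrW.imp ?_ ?_)
    · intro h w hw hwr
      by_cases hwC : w ∈ C
      · exact hrt (hadj w hwC r hr.1 hr.2 (.inl hwr))
      · exact h w ⟨hw, hwC⟩ hwr
    · intro h w hw hwr
      by_cases hwC : w ∈ C
      · exact hrt (hadj w hwC r hr.1 hr.2 (.inr hwr))
      · exact h w ⟨hw, hwC⟩ hwr
  exact ⟨t, htS, fun h => htC (h ▸ hsC), ht, hCt ▸ hC⟩

/-- An internal vertex of a walk has an in-neighbour and an out-neighbour on it. -/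
theorem exists_arcs_of_mem_chain {A : V → V → Prop} {u w x : V} {p : List V}
    (h : List.IsChain A (u :: (p ++ [w]))) (hx : x ∈ p) :
    (∃ y ∈ u :: (p ++ [w]), A y x) ∧ ∃ y ∈ u :: (p ++ [w]), A x y := by
  induction p generalizing u with
  | nil => simp at hx
  | cons a p ih =>
    rw [List.cons_append, List.isChain_cons_cons] at h
    rcases List.mem_cons.1 hx with rfl | hx
    · refine ⟨⟨u, by simp, h.1⟩, ?_⟩
      cases p with
      | nil => exact ⟨w, by simp, by simpa using h.2⟩
      | cons b p =>
        rw [List.cons_append, List.isChain_cons_cons] at h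
        exact ⟨b, by simp, h.2.1⟩
    · obtain ⟨⟨y, hy, hyx⟩, z, hz, hxz⟩ := ih h.2 hx
      exact ⟨⟨y, List.mem_cons_of_mem _ hy, hyx⟩, z, List.mem_cons_of_mem _ hz, hxz⟩

theorem DigraphConvex.diff_singleton {A : V → V → Prop} {S : Set V} {t : V}
    (hS : DigraphConvex A S) (ht : IsSourceIn A S t ∨ IsSinkIn A S t)
    (hne : (S \ {t}).Nonempty) : DigraphConvex A (S \ {t}) := by
  refine ⟨hne, fun u w p hu hw hp x hx => ?_⟩
  have hmem := hS.2 u w p hu.1 hw.1 hp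
  refine ⟨hmem x hx, ?_⟩
  rintro rfl
  have hall : ∀ y ∈ u :: (p ++ [w]), y ∈ S := by
    intro y hy
    simp only [List.mem_cons, List.mem_append, List.not_mem_nil, or_false] at hy
    rcases hy with rfl | hy | rfl
    exacts [hu.1, hmem y hy, hw.1]
  obtain ⟨⟨y, hy, hyx⟩, z, hz, hxz⟩ := exists_arcs_of_mem_chain hp.1 hx
  exact ht.elim (fun h => h y (hall y hy) hyx) fun h => h z (hall z hz) hxz

theorem DigraphCC.exists_removable [Finite V] {A : V → V → Prop} (hA : DigraphAcyclic A)
    {S : Set V} (hS : DigraphCC A S) {s : V} (hs : s ∈ S) (hcard : 1 < S.ncard) :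
    ∃ t ∈ S, t ≠ s ∧ DigraphCC A (S \ {t}) := by
  obtain ⟨x, hx, hxs⟩ := Set.exists_ne_of_one_lt_ncard hcard s
  obtain ⟨t, ht, hts, hsrc, hconn⟩ := hS.1.exists_removable hA hs hx hxs
  exact ⟨t, ht, hts, hconn, hS.2.diff_singleton hsrc hconn.1⟩

/-- A cc-set contains cc-subsets of every smaller positive size through any of its vertices. -/
theorem DigraphCC.exists_subset_ncard_eq [Finite V] {A : V → V → Prop} (hA : DigraphAcyclic A)
    {S : Set V} (hS : DigraphCC A S) {s : V} (hs : s ∈ S) {j : ℕ} (hj : 1 ≤ j)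
    (hjS : j ≤ S.ncard) : ∃ T ⊆ S, DigraphCC A T ∧ s ∈ T ∧ T.ncard = j := by
  induction hm : S.ncard - j generalizing S with
  | zero => exact ⟨S, subset_rfl, hS, hs, by omega⟩
  | succ m ih =>
    obtain ⟨t, ht, hts, hcc⟩ := hS.exists_removable hA hs (by omega)
    have hcard := Set.ncard_sdiff_singleton_of_mem ht
    obtain ⟨T, hT, h⟩ := ih hcc ⟨hs, hts.symm⟩ (by omega) (by omega)
    exact ⟨T, hT.trans Set.sdiff_subset, h⟩

theorem DigraphCC.ncard_le_ncard_subsets_mem [Finite V] {A : V → V → Prop}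
    (hA : DigraphAcyclic A) {S : Set V} (hS : DigraphCC A S) {s : V} (hs : s ∈ S) :
    S.ncard ≤ {T | DigraphCC A T ∧ T ⊆ S ∧ s ∈ T}.ncard := by
  have hsub : Set.Icc 1 S.ncard ⊆ Set.ncard '' {T | DigraphCC A T ∧ T ⊆ S ∧ s ∈ T} := by
    rintro j ⟨hj, hjS⟩
    obtain ⟨T, hTS, hT, hsT, rfl⟩ := hS.exists_subset_ncard_eq hA hs hj hjS
    exact ⟨T, ⟨hT, hTS, hsT⟩, rfl⟩
  calc S.ncard = (Set.Icc 1 S.ncard).ncard := by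
        rw [← Finset.coe_Icc, Set.ncard_coe_finset, Nat.card_Icc, Nat.add_sub_cancel]
    _ ≤ _ := Set.ncard_le_ncard hsub (Set.toFinite _)
    _ ≤ _ := Set.ncard_image_le (Set.toFinite _)

theorem DigraphCC.le_two_mul_ncard_subsets [Finite V] {A : V → V → Prop}
    (hA : DigraphAcyclic A) {S : Set V} (hS : DigraphCC A S) :
    S.ncard * (S.ncard + 1) ≤ 2 * {T | DigraphCC A T ∧ T ⊆ S}.ncard := by
  induction hk : S.ncard generalizing S with
  | zero => simp
  | succ k ih =>
    obtain ⟨s, hs⟩ := hS.1.1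
    obtain rfl | hk0 := Nat.eq_zero_or_pos k
    · have : 0 < {T | DigraphCC A T ∧ T ⊆ S}.ncard :=
        (Set.ncard_pos (Set.toFinite _)).2 ⟨S, hS, subset_rfl⟩
      omega
    obtain ⟨t, ht, -, hcc⟩ := hS.exists_removable hA hs (by omega)
    have hcard := Set.ncard_sdiff_singleton_of_mem ht
    have h1 := ih hcc (by omega)
    have h2 := hS.ncard_le_ncard_subsets_mem hA ht
    have hdisj : Disjoint {T | DigraphCC A T ∧ T ⊆ S \ {t}}
        {T | DigraphCC A T ∧ T ⊆ S ∧ t ∈ T} :=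
      Set.disjoint_left.2 fun T hT hT' => (hT.2 hT'.2.2).2 rfl
    have hunion := Set.ncard_union_eq hdisj (Set.toFinite _) (Set.toFinite _)
    have hle : ({T | DigraphCC A T ∧ T ⊆ S \ {t}} ∪
        {T | DigraphCC A T ∧ T ⊆ S ∧ t ∈ T}).ncard ≤ {T | DigraphCC A T ∧ T ⊆ S}.ncard :=
      Set.ncard_le_ncard (Set.union_subset (fun T hT => ⟨hT.1, hT.2.trans Set.sdiff_subset⟩)
        fun T hT => ⟨hT.1, hT.2.1⟩) (Set.toFinite _)
    nlinarith

end Helpers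

/-- Every connected acyclic digraph of order n has at least n(n+1)/2
connected convex sets. -/
theorem cc_lower_bound {V : Type*} [Fintype V] (A : V → V → Prop) (n : ℕ)
    (hn : Fintype.card V = n) (hA : DigraphAcyclic A) (hconn : DigraphConnected A) :
    Set.ncard {S : Set V | DigraphCC A S} ≥ n * (n + 1) / 2 := by
  obtain rfl | hpos := Nat.eq_zero_or_pos n
  · simp
  have : Nonempty V := Fintype.card_pos_iff.1 (hn ▸ hpos)
  have huniv : DigraphCC A Set.univ :=
    ⟨⟨Set.univ_nonempty, fun x _ y _ => by simpa using hconn x y⟩,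
      Set.univ_nonempty, fun _ _ _ _ _ _ x _ => Set.mem_univ x⟩
  have h := huniv.le_two_mul_ncard_subsets hA
  simp only [Set.subset_univ, and_true, Set.ncard_univ, Nat.card_eq_fintype_card, hn] at h
  omega
end

section
/- If an acyclic digraph D of order n has a Hamiltonian directed path, then the number cc(D) of connected convex sets of D equals n(n+1)/2. -/
variable {V : Type*}

open Relation in
/-- In an acyclic digraph whose reachability relation is a linear order, every
arc goes from a smaller vertex to a larger one. -/
theorem lt_of_arc_of_acyclic {V : Type*} [LinearOrder V] {A : V → V → Prop}
    (hA : DigraphAcyclic A) (hle : ∀ a b : V, a ≤ b ↔ ReflTransGen A a b) {a b : V}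
    (h : A a b) : a < b := by
  refine lt_of_not_ge fun hba => hA a ?_
  exact TransGen.head' h ((hle b a).1 hba)

open Relation in
/-- Reachability is witnessed by a list of vertices. -/
theorem exists_chain_of_transGen {V : Type*} {A : V → V → Prop} {a b : V}
    (h : TransGen A a b) : ∃ p : List V, List.IsChain A (a :: (p ++ [b])) := by
  induction h using TransGen.head_induction_on with
  | single h => exact ⟨[], by simpa using h⟩
  | head h _ ih =>
    obtain ⟨p, hp⟩ := ih
    exact ⟨_ :: p, List.IsChain.cons_cons h hp⟩

open Relation in
/-- If reachability in an acyclic digraph is a linear order, convex sets are order-convex. -/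
theorem DigraphConvex.ordConnected {V : Type*} [LinearOrder V] {A : V → V → Prop}
    (hA : DigraphAcyclic A) (hle : ∀ a b : V, a ≤ b ↔ ReflTransGen A a b) {S : Set V}
    (hS : DigraphConvex A S) : S.OrdConnected := by
  have transGen_of_lt {a b : V} (h : a < b) : TransGen A a b :=
    (reflTransGen_iff_eq_or_transGen.1 ((hle a b).1 h.le)).resolve_left h.ne'
  refine ⟨fun u hu w hw x hx => ?_⟩
  rcases hx.1.eq_or_lt with rfl | hux
  · exact hu
  rcases hx.2.eq_or_lt with rfl | hxw
  · exact hw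
  obtain ⟨p, hp⟩ := exists_chain_of_transGen (transGen_of_lt hux)
  obtain ⟨q, hq⟩ := exists_chain_of_transGen (transGen_of_lt hxw)
  have hchain : List.IsChain A (u :: ((p ++ x :: q) ++ [w])) := by
    have := List.IsChain.append_overlap (l₁ := u :: p) (l₂ := [x]) (l₃ := q ++ [w])
      (by simpa using hp) (by simpa using hq) (by simp)
    simpa using this
  refine hS.2 u w (p ++ x :: q) hu hw ⟨?_, ?_⟩ x (by simp)
  · exact hchain
  · exact ((hchain.imp fun _ _ => lt_of_arc_of_acyclic hA hle).pairwise).imp ne_of_lt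

open Relation in
/-- If reachability in an acyclic digraph is a linear order, its intervals are cc-sets. -/
theorem digraphCC_Icc {V : Type*} [LinearOrder V] {A : V → V → Prop}
    (hA : DigraphAcyclic A) (hle : ∀ a b : V, a ≤ b ↔ ReflTransGen A a b) {a b : V}
    (hab : a ≤ b) : DigraphCC A (Set.Icc a b) := by
  have hne : (Set.Icc a b).Nonempty := Set.nonempty_Icc.2 hab
  have hconn : ∀ x ∈ Set.Icc a b, ∀ y ∈ Set.Icc a b, x ≤ y → ReflTransGen
      (fun u v => u ∈ Set.Icc a b ∧ v ∈ Set.Icc a b ∧ (A u v ∨ A v u)) x y := by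
    intro x hx y hy hxy
    have h := (hle x y).1 hxy
    induction h using ReflTransGen.head_induction_on with
    | refl => exact .refl
    | @head u v huv hvy ih =>
      have hv : v ∈ Set.Icc a b :=
        ⟨hx.1.trans (lt_of_arc_of_acyclic hA hle huv).le, ((hle _ _).2 hvy).trans hy.2⟩
      exact (ih hv ((hle _ _).2 hvy)).head ⟨hx, hv, .inl huv⟩
  refine ⟨⟨hne, fun x hx y hy => ?_⟩, hne, fun u w p hu hw hp x hx => ?_⟩
  · rcases le_total x y with h | h
    · exact hconn x hx y hy h
    · have : Std.Symm fun u v => u ∈ Set.Icc a b ∧ v ∈ Set.Icc a b ∧ (A u v ∨ A v u) :=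
        ⟨fun _ _ h => ⟨h.2.1, h.1, h.2.2.symm⟩⟩
      exact ReflTransGen.stdSymm.symm _ _ (hconn y hy x hx h)
  · have hchain : List.IsChain A (u :: (p ++ [w])) := hp.1
    have hpw := (hchain.imp fun _ _ => lt_of_arc_of_acyclic hA hle).pairwise
    rw [List.pairwise_cons, List.pairwise_append] at hpw
    exact ⟨hu.1.trans (hpw.1 x (by simp [hx])).le,
      (hpw.2.2.2 x hx w (by simp)).le.trans hw.2⟩

/-- If reachability in a finite acyclic digraph is a linear order, the cc-sets are exactly the
nonempty closed intervals. -/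
theorem digraphCC_iff_exists_Icc {V : Type*} [Finite V] [LinearOrder V] {A : V → V → Prop}
    (hA : DigraphAcyclic A) (hle : ∀ a b : V, a ≤ b ↔ Relation.ReflTransGen A a b) {S : Set V} :
    DigraphCC A S ↔ ∃ a b : V, a ≤ b ∧ Set.Icc a b = S := by
  constructor
  · rintro ⟨-, hS⟩
    have := hS.ordConnected hA hle
    obtain ⟨a, ha⟩ := S.toFinite.exists_minimal hS.1
    obtain ⟨b, hb⟩ := S.toFinite.exists_maximal hS.1
    have hlower : ∀ x ∈ S, a ≤ x := fun x hx => le_of_not_gt (ha.not_lt hx)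
    have hupper : ∀ x ∈ S, x ≤ b := fun x hx => le_of_not_gt (hb.not_gt hx)
    exact ⟨a, b, hlower b hb.prop, (this.out ha.prop hb.prop).antisymm
      fun x hx => ⟨hlower x hx, hupper x hx⟩⟩
  · rintro ⟨a, b, hab, rfl⟩
    exact digraphCC_Icc hA hle hab

/-- A finite linear order with `n` elements has `n (n + 1) / 2` nonempty closed intervals. -/
theorem ncard_setOf_nonempty_Icc (V : Type*) [Fintype V] [LinearOrder V] :
    {S : Set V | ∃ a b : V, a ≤ b ∧ Set.Icc a b = S}.ncard =
      Fintype.card V * (Fintype.card V + 1) / 2 := by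
  have himage : {S : Set V | ∃ a b : V, a ≤ b ∧ Set.Icc a b = S} =
      (fun p : V × V => Set.Icc p.1 p.2) '' {p | p.1 ≤ p.2} := by
    ext S
    simp
  have hinj : Set.InjOn (fun p : V × V => Set.Icc p.1 p.2) {p | p.1 ≤ p.2} := by
    rintro ⟨a, b⟩ hab ⟨c, d⟩ - h
    simpa using (Set.Icc_eq_Icc_iff hab).1 h
  rw [himage, hinj.ncard_image, ← Nat.card_coe_set_eq,
    Set.coe_ofPred, ← Nat.card_congr (Sym2.sortEquiv (α := V)), Nat.card_eq_fintype_card, Sym2.card,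
    Nat.choose_two_right, Nat.add_sub_cancel, mul_comm]

open Relation in
/-- Reachability in an acyclic digraph with a Hamiltonian directed path is a linear order. -/
theorem exists_linearOrder_le_iff_reflTransGen {V : Type*} {A : V → V → Prop}
    (hA : DigraphAcyclic A) {l : List V} (hl : ∀ v : V, v ∈ l) (hchain : l.IsChain A) :
    ∃ _ : LinearOrder V, ∀ a b : V, a ≤ b ↔ ReflTransGen A a b := by
  have hpw : l.Pairwise fun a b => ReflTransGen A a b ∨ ReflTransGen A b a :=
    (hchain.imp fun _ _ => ReflTransGen.single).pairwise.imp Or.inl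
  have : Std.Symm fun a b : V => ReflTransGen A a b ∨ ReflTransGen A b a :=
    ⟨fun _ _ => Or.symm⟩
  have htotal (a b : V) : ReflTransGen A a b ∨ ReflTransGen A b a :=
    List.Pairwise.forall_of_forall (R := fun a b => ReflTransGen A a b ∨ ReflTransGen A b a)
      (fun _ _ => Or.inl .refl) hpw (hl a) (hl b)
  refine ⟨{ le := ReflTransGen A
            le_refl := fun _ => .refl
            le_trans := fun _ _ _ => .trans
            le_antisymm := fun a b hab hba => ?_
            le_total := htotal
            toDecidableLE := Classical.decRel _ }, fun _ _ => Iff.rfl⟩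
  by_contra hne
  exact hA a (((reflTransGen_iff_eq_or_transGen.1 hab).resolve_left (Ne.symm hne)).trans_left hba)

/-- If an acyclic digraph of order n has a Hamiltonian directed path,
then it has exactly n(n+1)/2 connected convex sets. -/
theorem cc_eq_of_hamiltonian_path {V : Type*} [Fintype V] (A : V → V → Prop) (n : ℕ)
    (hn : Fintype.card V = n) (hA : DigraphAcyclic A)
    (hham : ∃ l : List V, l.Nodup ∧ (∀ v : V, v ∈ l) ∧ l.Chain' A) :
    Set.ncard {S : Set V | DigraphCC A S} = n * (n + 1) / 2 := by
  obtain ⟨l, -, hl, hchain⟩ := hham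
  obtain ⟨_, hle⟩ := exists_linearOrder_le_iff_reflTransGen hA hl hchain
  simp only [digraphCC_iff_exists_Icc hA hle]
  rw [ncard_setOf_nonempty_Icc, hn]
end

section
/- Let f(n) = 2^n + n + 1 − d_n, where d_n = 2·2^(n/2) when n is even and d_n = 3·2^((n−1)/2) when n is odd. For every connected acyclic digraph D of order n, the number cc(D) of connected convex sets of D satisfies cc(D) ≤ f(n). -/
variable {V : Type*}

/-- The quantity d_n from Theorem "upper_bound". -/
def dBound (n : ℕ) : ℕ := if Even n then 2 * 2 ^ (n / 2) else 3 * 2 ^ ((n - 1) / 2)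

/-- The upper bound f(n) = 2^n + n + 1 - d_n. -/
def fBound (n : ℕ) : ℕ := 2 ^ n + n + 1 - dBound n

/-- A relaxation of being a cc-set of the subdigraph induced by `U`: no vertex of `S` is isolated
in `S` unless it is the only one, and `S` is closed under midpoints in `U` of two-arc paths. -/
def IsLocallyCC (A : V → V → Prop) (U S : Finset V) : Prop :=
  S.Nonempty ∧ (∀ x ∈ S, ∀ z ∈ S, z ≠ x → ∃ y ∈ S, A x y ∨ A y x) ∧
    ∀ u ∈ S, ∀ w ∈ S, ∀ v ∈ U, A u v → A v w → v ∈ S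

open Classical in
/-- The subsets of `U` that are locally cc in `U`. -/
noncomputable def locallyCCSets (A : V → V → Prop) (U : Finset V) : Finset (Finset V) :=
  U.powerset.filter (IsLocallyCC A U)

open Classical in
/-- The vertices of `U` other than `x` that are not adjacent to `x`. -/
noncomputable def nonNeighbors (A : V → V → Prop) (U : Finset V) (x : V) : Finset V :=
  (U.erase x).filter fun y => ¬ (A x y ∨ A y x)

theorem DigraphAcyclic.swap {A : V → V → Prop} (hA : DigraphAcyclic A) :
    DigraphAcyclic (Function.swap A) := fun v h => hA v (Relation.transGen_swap.1 h)

theorem DigraphAcyclic.exists_isSourceIn_s5 {A : V → V → Prop} (hA : DigraphAcyclic A)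
    {U : Finset V} (hU : U.Nonempty) : ∃ s ∈ U, IsSourceIn A U s := by
  have : Std.Irrefl (Relation.TransGen A) := ⟨hA⟩
  have : IsTrans V (Relation.TransGen A) := ⟨fun _ _ _ => Relation.TransGen.trans⟩
  have : IsStrictOrder V (Relation.TransGen A) := {}
  have hwf : (U : Set V).WellFoundedOn (Relation.TransGen A) :=
    U.finite_toSet.wellFoundedOn
  obtain ⟨⟨s, hs⟩, -, hmin⟩ := hwf.has_min Set.univ ⟨⟨hU.choose, hU.choose_spec⟩, trivial⟩
  exact ⟨s, hs, fun y hy h => hmin ⟨y, hy⟩ trivial (.single h)⟩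

theorem DigraphAcyclic.exists_isSinkIn_s5 {A : V → V → Prop} (hA : DigraphAcyclic A)
    {U : Finset V} (hU : U.Nonempty) : ∃ t ∈ U, IsSinkIn A U t :=
  hA.swap.exists_isSourceIn_s5 hU

theorem dBound_succ (n : ℕ) : dBound (n + 1) = dBound n + 2 ^ (n / 2) := by
  unfold dBound
  rcases Nat.even_or_odd' n with ⟨k, rfl | rfl⟩
  · have h : ¬ Even (2 * k + 1) := by simp
    rw [if_neg h, if_pos (even_two_mul k)]
    simp only [Nat.add_sub_cancel, Nat.mul_div_cancel_left k two_pos]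
    ring
  · have h : ¬ Even (2 * k + 1) := by simp
    rw [if_pos (by simp [Nat.even_add_one]), if_neg h]
    have h₁ : (2 * k + 1 + 1) / 2 = k + 1 := by omega
    have h₂ : (2 * k + 1 - 1) / 2 = k := by omega
    have h₃ : (2 * k + 1) / 2 = k := by omega
    rw [h₁, h₂, h₃]
    ring

open Classical in
theorem card_locallyCCSets_add_le {A : V → V → Prop} {U : Finset V} {x : V} (hx : x ∈ U)
    {B : Finset (Finset V)} (hB : ∀ S ∈ B, S ⊆ U ∧ x ∈ S ∧ ¬ IsLocallyCC A U S) :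
    (locallyCCSets A U).card + B.card ≤
      (locallyCCSets A (U.erase x)).card + 2 ^ (U.card - 1) := by
  have hcard : (Finset.Icc {x} U).card = 2 ^ (U.card - 1) := by
    rw [Finset.card_Icc_finset (by simpa using hx), Finset.card_singleton]
  have hdisj : Disjoint (locallyCCSets A U) B :=
    Finset.disjoint_left.2 fun S hS hS' => (hB S hS').2.2 (Finset.mem_filter.1 hS).2
  rw [← Finset.card_union_of_disjoint hdisj, ← hcard]
  refine (Finset.card_le_card fun S hS => ?_).trans (Finset.card_union_le _ _)
  rw [Finset.mem_union, Finset.mem_Icc]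
  have hSU : S ⊆ U := (Finset.mem_union.1 hS).elim
    (fun h => Finset.mem_powerset.1 (Finset.mem_filter.1 h).1) fun h => (hB S h).1
  by_cases hxS : x ∈ S
  · exact .inr ⟨by simpa using hxS, hSU⟩
  · have hcc := (Finset.mem_filter.1
      ((Finset.mem_union.1 hS).resolve_right fun h => hxS (hB S h).2.1)).2
    exact .inl (Finset.mem_filter.2 ⟨Finset.mem_powerset.2 (Finset.subset_erase.2 ⟨hSU, hxS⟩),
      hcc.1, hcc.2.1, fun u hu w hw v hv => hcc.2.2 u hu w hw v (Finset.mem_of_mem_erase hv)⟩)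

open Classical in
/-- Sets made of `x` and some of its non-neighbors are disconnected. -/
theorem card_locallyCCSets_of_nonNeighbors {A : V → V → Prop} (hA : DigraphAcyclic A)
    {U : Finset V} {x : V} (hx : x ∈ U) :
    (locallyCCSets A U).card + 2 ^ (nonNeighbors A U x).card ≤
      (locallyCCSets A (U.erase x)).card + 2 ^ (U.card - 1) + 1 := by
  set M := nonNeighbors A U x with hM
  have hxM : x ∉ M := by simp [hM, nonNeighbors]
  have hcard : ((Finset.Icc {x} (insert x M)).erase {x}).card = 2 ^ M.card - 1 := by
    rw [Finset.card_erase_of_mem (by simp), Finset.card_Icc_finset (by simp),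
      Finset.card_insert_of_notMem hxM, Finset.card_singleton, Nat.add_sub_cancel]
  have h := card_locallyCCSets_add_le (A := A) hx
    (B := (Finset.Icc {x} (insert x M)).erase {x}) ?_
  · have := Nat.one_le_two_pow (n := M.card)
    omega
  intro S hS
  obtain ⟨hne, hS⟩ := Finset.mem_erase.1 hS
  obtain ⟨hxS, hSM⟩ := Finset.mem_Icc.1 hS
  replace hxS : x ∈ S := by simpa using hxS
  have hMU : M ⊆ U := (Finset.filter_subset _ _).trans (Finset.erase_subset _ _)
  refine ⟨hSM.trans (Finset.insert_subset hx hMU), hxS, fun hcc => ?_⟩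
  obtain ⟨z, hz, hzx⟩ : ∃ z ∈ S, z ≠ x := by
    by_contra! hall
    exact hne (Finset.eq_singleton_iff_unique_mem.2 ⟨hxS, hall⟩)
  obtain ⟨y, hy, hxy⟩ := hcc.2.1 x hxS z hz hzx
  rcases Finset.mem_insert.1 (hSM hy) with rfl | hyM
  · exact hA y (.single (hxy.elim id id))
  · exact (Finset.mem_filter.1 hyM).2 hxy

open Classical in
/-- Sets containing the ends but not the midpoint of a two-arc path are not convex. -/
theorem card_locallyCCSets_of_path {A : V → V → Prop} (hA : DigraphAcyclic A)
    {U : Finset V} {s v t : V} (hs : s ∈ U) (hv : v ∈ U) (ht : t ∈ U) (hsv : A s v)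
    (hvt : A v t) :
    (locallyCCSets A U).card + 2 ^ (U.card - 3) ≤
      (locallyCCSets A (U.erase s)).card + 2 ^ (U.card - 1) := by
  have hsv' : s ≠ v := by rintro rfl; exact hA s (.single hsv)
  have hvt' : t ≠ v := by rintro rfl; exact hA t (.single hvt)
  have hst : s ≠ t := by rintro rfl; exact hA s (.tail (.single hsv) hvt)
  have hsub : {s, t} ⊆ U.erase v := by simp [Finset.insert_subset_iff, *]
  have hcard : (Finset.Icc {s, t} (U.erase v)).card = 2 ^ (U.card - 3) := by
    rw [Finset.card_Icc_finset hsub, Finset.card_erase_of_mem hv, Finset.card_pair hst,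
      Nat.sub_sub]
  rw [← hcard]
  refine card_locallyCCSets_add_le hs fun S hS => ?_
  obtain ⟨hstS, hSU⟩ := Finset.mem_Icc.1 hS
  have hsS : s ∈ S := hstS (by simp)
  have htS : t ∈ S := hstS (by simp)
  exact ⟨hSU.trans (Finset.erase_subset _ _), hsS, fun hcc =>
    Finset.notMem_erase v U (hSU (hcc.2.2 s hsS t htS v hv hsv hvt))⟩

theorem exists_path_of_card_nonNeighbors_lt {A : V → V → Prop} {U : Finset V} {s t : V}
    (hs : IsSourceIn A U s) (ht : IsSinkIn A U t)
    (hcard : (nonNeighbors A U s).card + (nonNeighbors A U t).card + 2 < U.card) :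
    ∃ v ∈ U, A s v ∧ A v t := by
  classical
  have hlt : ((nonNeighbors A U s ∪ nonNeighbors A U t) ∪ {s, t}).card < U.card := by
    have h₁ := Finset.card_union_le (nonNeighbors A U s ∪ nonNeighbors A U t) {s, t}
    have h₂ := Finset.card_union_le (nonNeighbors A U s) (nonNeighbors A U t)
    have h₃ := Finset.card_le_two (a := s) (b := t)
    omega
  obtain ⟨v, hv, hvn⟩ := Finset.exists_mem_notMem_of_card_lt_card hlt
  simp only [nonNeighbors, Finset.mem_union, Finset.mem_filter, Finset.mem_erase,
    Finset.mem_insert, Finset.mem_singleton] at hvn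
  have hsv := hs v hv
  have hvt := ht v hv
  exact ⟨v, hv, by tauto, by tauto⟩

theorem card_locallyCCSets_le {A : V → V → Prop} (hA : DigraphAcyclic A) (U : Finset V) :
    (locallyCCSets A U).card + dBound U.card ≤ 2 ^ U.card + U.card + 1 := by
  classical
  obtain ⟨n, hn⟩ : ∃ n, U.card = n := ⟨_, rfl⟩
  rw [hn]
  induction n generalizing U with
  | zero =>
    obtain rfl := Finset.card_eq_zero.1 hn
    simp [locallyCCSets, IsLocallyCC, dBound, Finset.filter_singleton]
  | succ n ih =>
    suffices ∃ x ∈ U, (locallyCCSets A U).card + 2 ^ (n / 2) ≤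
        (locallyCCSets A (U.erase x)).card + 2 ^ n + 1 by
      obtain ⟨x, hx, h⟩ := this
      have := ih (U.erase x) (by rw [Finset.card_erase_of_mem hx, hn, Nat.add_sub_cancel])
      rw [dBound_succ, pow_succ]
      omega
    by_cases hlow : ∃ x ∈ U, n / 2 ≤ (nonNeighbors A U x).card
    · obtain ⟨x, hx, hle⟩ := hlow
      have h := card_locallyCCSets_of_nonNeighbors hA hx
      rw [hn, Nat.add_sub_cancel] at h
      have := Nat.pow_le_pow_right two_pos hle
      exact ⟨x, hx, by omega⟩
    · push Not at hlow
      have hU : U.Nonempty := Finset.card_pos.1 (by omega)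
      obtain ⟨s, hsU, hs⟩ := hA.exists_isSourceIn_s5 hU
      obtain ⟨t, htU, ht⟩ := hA.exists_isSinkIn_s5 hU
      have hls := hlow s hsU
      have hlt := hlow t htU
      obtain ⟨v, hvU, hsv, hvt⟩ := exists_path_of_card_nonNeighbors_lt hs ht (by omega)
      have h := card_locallyCCSets_of_path hA hsU hvU htU hsv hvt
      rw [hn, Nat.add_sub_cancel] at h
      refine ⟨s, hsU, ?_⟩
      have : 2 ^ (n / 2) ≤ 2 ^ (n + 1 - 3) + 1 := by
        obtain rfl | hn2 : n = 2 ∨ n / 2 ≤ n + 1 - 3 := by omega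
        · norm_num
        · exact (Nat.pow_le_pow_right two_pos hn2).trans (Nat.le_succ _)
      omega

theorem DigraphCC.isLocallyCC {A : V → V → Prop} (hA : DigraphAcyclic A) {U S : Finset V}
    (h : DigraphCC A (S : Set V)) : IsLocallyCC A U S := by
  refine ⟨by simpa using h.1.1, fun x hx z hz hzx => ?_, fun u hu w hw v _ huv hvw => ?_⟩
  · rcases (h.1.2 x hx z hz).cases_head with rfl | ⟨y, ⟨-, hy, hxy⟩, -⟩
    · exact absurd rfl hzx
    · exact ⟨y, hy, hxy⟩
  · have huv' : u ≠ v := by rintro rfl; exact hA u (.single huv)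
    have hvw' : v ≠ w := by rintro rfl; exact hA v (.single hvw)
    have huw : u ≠ w := by rintro rfl; exact hA u (.tail (.single huv) hvw)
    exact h.2.2 u w [v] hu hw ⟨by simp [List.Chain, huv, hvw], by simp [*]⟩ v (by simp)

/-- Every connected acyclic digraph of order n has at most f(n)
connected convex sets. -/
theorem cc_upper_bound {V : Type*} [Fintype V] (A : V → V → Prop) (n : ℕ)
    (hn : Fintype.card V = n) (hA : DigraphAcyclic A) (hconn : DigraphConnected A) :
    Set.ncard {S : Set V | DigraphCC A S} ≤ fBound n := by
  classical
  have hbound := card_locallyCCSets_le hA Finset.univ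
  rw [Finset.card_univ, hn] at hbound
  have hsub : {S : Set V | DigraphCC A S} ⊆
      (fun S : Finset V => (S : Set V)) '' (locallyCCSets A Finset.univ : Set (Finset V)) := by
    intro S hS
    have hcoe : (S.toFinset : Set V) = S := Set.coe_toFinset S
    refine ⟨S.toFinset, Finset.mem_filter.2 ⟨by simp, DigraphCC.isLocallyCC hA ?_⟩, hcoe⟩
    rwa [hcoe]
  have hle := (Set.ncard_le_ncard hsub (Set.toFinite _)).trans (Set.ncard_image_le (Set.toFinite _))
  rw [Set.ncard_coe_finset] at hle
  unfold fBound
  omega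
end

section
/- Let f(n) = 2^n + n + 1 − d_n, where d_n = 2·2^(n/2) when n is even and d_n = 3·2^((n−1)/2) when n is odd. Let K⃗_{p,q} denote the digraph obtained from the complete bipartite graph K_{p,q} by orienting every edge from the partite set of cardinality p to the partite set of cardinality q. If a and n are integers with 1 ≤ a ≤ n−1 and |n − 2a| ≤ 1, then cc(K⃗_{a,n−a}) = f(n). -/
variable {V : Type*}

/-- The arc relation of K⃗_{p,q}: the complete bipartite graph with partite sets of
sizes p and q, with every edge oriented from the first partite set to the second. -/
def completeBipartiteOrientation (p q : ℕ) : (Fin p ⊕ Fin q) → (Fin p ⊕ Fin q) → Prop :=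
  fun x y => match x, y with
    | Sum.inl _, Sum.inr _ => True
    | _, _ => False

theorem not_isChain_completeBipartiteOrientation_cons_cons {p q : ℕ} (x y z : Fin p ⊕ Fin q)
    (l : List (Fin p ⊕ Fin q)) :
    ¬ List.IsChain (completeBipartiteOrientation p q) (x :: y :: z :: l) := by
  rcases x with x | x <;> rcases y with y | y <;> rcases z with z | z <;>
    simp [completeBipartiteOrientation]

theorem digraphConvex_completeBipartiteOrientation {p q : ℕ} {S : Set (Fin p ⊕ Fin q)}
    (hS : S.Nonempty) : DigraphConvex (completeBipartiteOrientation p q) S := by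
  refine ⟨hS, fun u w l _ _ hl => ?_⟩
  match l with
  | [] => simp
  | [x] => exact (not_isChain_completeBipartiteOrientation_cons_cons _ _ _ _ hl.1).elim
  | x :: y :: l => exact (not_isChain_completeBipartiteOrientation_cons_cons _ _ _ _ hl.1).elim

theorem digraphCC_completeBipartiteOrientation_iff {p q : ℕ} {S : Set (Fin p ⊕ Fin q)} :
    DigraphCC (completeBipartiteOrientation p q) S ↔
      (∃ x, {x} = S) ∨ (Sum.inl ⁻¹' S).Nonempty ∧ (Sum.inr ⁻¹' S).Nonempty := by
  constructor
  · rintro ⟨⟨⟨x, hx⟩, hconn⟩, -⟩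
    by_cases hsub : ∀ y ∈ S, y = x
    · exact Or.inl ⟨x, (Set.eq_singleton_iff_unique_mem.2 ⟨hx, hsub⟩).symm⟩
    · push Not at hsub
      obtain ⟨y, hy, hyx⟩ := hsub
      rcases (hconn x hx y hy).cases_head with h | ⟨z, ⟨-, hz, hxz⟩, -⟩
      · exact (hyx h.symm).elim
      · right
        rcases x with i | j <;> rcases z with i' | j'
        · simp [completeBipartiteOrientation] at hxz
        · exact ⟨⟨i, hx⟩, ⟨j', hz⟩⟩
        · exact ⟨⟨i', hz⟩, ⟨j, hx⟩⟩
        · simp [completeBipartiteOrientation] at hxz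
  · rintro (⟨x, rfl⟩ | ⟨⟨i, hi⟩, ⟨j, hj⟩⟩)
    · refine ⟨⟨Set.singleton_nonempty x, ?_⟩,
        digraphConvex_completeBipartiteOrientation (Set.singleton_nonempty x)⟩
      rintro _ rfl _ rfl
      exact .refl
    · refine ⟨⟨⟨_, hi⟩, ?_⟩, digraphConvex_completeBipartiteOrientation ⟨_, hi⟩⟩
      have hij {k : Fin p} {m : Fin q} : completeBipartiteOrientation p q (.inl k) (.inr m) :=
        trivial
      rintro (k | k) hk (m | m) hm
      · exact .head ⟨hk, hj, .inl hij⟩ (.single ⟨hj, hm, .inr hij⟩)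
      · exact .single ⟨hk, hm, .inl hij⟩
      · exact .single ⟨hk, hm, .inr hij⟩
      · exact .head ⟨hk, hi, .inr hij⟩ (.single ⟨hi, hm, .inl hij⟩)

theorem ncard_setOf_set_nonempty (α : Type*) [Finite α] :
    {s : Set α | s.Nonempty}.ncard = 2 ^ Nat.card α - 1 := by
  have := Fintype.ofFinite α
  have h : {s : Set α | s.Nonempty} = {∅}ᶜ := by
    ext s
    simp [Set.nonempty_iff_ne_empty]
  rw [h, Set.ncard_compl, Set.ncard_singleton, Nat.card_eq_fintype_card, Fintype.card_set,
    Nat.card_eq_fintype_card]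

theorem ncard_digraphCC_completeBipartiteOrientation (p q : ℕ) :
    {S : Set (Fin p ⊕ Fin q) | DigraphCC (completeBipartiteOrientation p q) S}.ncard =
      p + q + (2 ^ p - 1) * (2 ^ q - 1) := by
  have h : {S : Set (Fin p ⊕ Fin q) | DigraphCC (completeBipartiteOrientation p q) S} =
      Set.range (fun x => ({x} : Set (Fin p ⊕ Fin q))) ∪
        Set.sumEquiv.symm '' ({s : Set (Fin p) | s.Nonempty} ×ˢ {t : Set (Fin q) | t.Nonempty}) := by
    ext S
    rw [Set.mem_ofPred_eq, digraphCC_completeBipartiteOrientation_iff]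
    refine or_congr Iff.rfl ⟨fun hS => ⟨Set.sumEquiv S, hS, Set.sumEquiv.symm_apply_apply S⟩, ?_⟩
    rintro ⟨⟨s, t⟩, ⟨hs, ht⟩, rfl⟩
    simpa [Set.sumEquiv, Set.preimage_image_eq _ Sum.inl_injective,
      Set.preimage_image_eq _ Sum.inr_injective] using And.intro hs ht
  rw [h, Set.ncard_union_eq, Set.ncard_range_of_injective Set.singleton_injective,
    Set.ncard_image_of_injective _ Set.sumEquiv.symm.injective, Set.ncard_prod,
    ncard_setOf_set_nonempty, ncard_setOf_set_nonempty]
  · simp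
  · rw [Set.disjoint_left]
    rintro _ ⟨x, rfl⟩ ⟨⟨s, t⟩, ⟨⟨i, hi⟩, ⟨j, hj⟩⟩, hst⟩
    have hi' : Sum.inl i ∈ ({x} : Set (Fin p ⊕ Fin q)) :=
      hst.subset (Or.inl ⟨i, hi, rfl⟩)
    have hj' : Sum.inr j ∈ ({x} : Set (Fin p ⊕ Fin q)) :=
      hst.subset (Or.inr ⟨j, hj, rfl⟩)
    exact Sum.inl_ne_inr (hi'.trans hj'.symm)

theorem dBound_eq_two_pow_add_two_pow {p q : ℕ} (h : |(p : ℤ) - q| ≤ 1) :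
    dBound (p + q) = 2 ^ p + 2 ^ q := by
  rw [abs_le] at h
  obtain rfl | rfl | rfl : p = q ∨ p = q + 1 ∨ q = p + 1 := by omega
  · rw [dBound, if_pos ⟨p, rfl⟩, show (p + p) / 2 = p by omega]
    ring
  · rw [dBound, if_neg (by grind), show (q + 1 + q - 1) / 2 = q by omega]
    ring
  · rw [dBound, if_neg (by grind), show (p + (p + 1) - 1) / 2 = p by omega]
    ring

/-- If 1 ≤ a ≤ n − 1 and |n − 2a| ≤ 1, then cc(K⃗_{a,n−a}) = f(n). -/
theorem cc_completeBipartiteOrientation_eq (n a : ℕ) (h1 : 1 ≤ a) (h2 : a ≤ n - 1)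
    (h3 : |(n : ℤ) - 2 * (a : ℤ)| ≤ 1) :
    Set.ncard {S : Set (Fin a ⊕ Fin (n - a)) |
        DigraphCC (completeBipartiteOrientation a (n - a)) S} = fBound n := by
  obtain ⟨b, rfl⟩ := Nat.exists_eq_add_of_le (show a ≤ n by omega)
  rw [Nat.add_sub_cancel_left, ncard_digraphCC_completeBipartiteOrientation, fBound,
    dBound_eq_two_pow_add_two_pow (by rw [abs_le] at h3 ⊢; omega), pow_add]
  obtain ⟨x, hx⟩ := Nat.exists_eq_add_of_le' (Nat.one_le_two_pow (n := a))
  obtain ⟨y, hy⟩ := Nat.exists_eq_add_of_le' (Nat.one_le_two_pow (n := b))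
  rw [hx, hy, Nat.add_sub_cancel, Nat.add_sub_cancel]
  refine Nat.eq_sub_of_add_eq ?_
  ring
end

section
/- Let D be an acyclic digraph, let X be a convex set of vertices of D, and let s ∈ X be a source or a sink of the subdigraph D[X] induced by X. If X \ {s} is nonempty, then X \ {s} is a convex set of D. -/
variable {V : Type*}

/-- In a chain, every element after the first has a predecessor. -/
theorem List.IsChain.exists_rel_of_cons_append_cons {A : V → V → Prop} {u s : V}
    {p q : List V} (h : List.IsChain A (u :: (p ++ s :: q))) : ∃ y ∈ u :: p, A y s := by
  induction p generalizing u with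
  | nil => exact ⟨u, by simp, by simp_all⟩
  | cons v p ih =>
    obtain ⟨y, hy, hys⟩ := ih (List.isChain_cons_cons.1 h).2
    exact ⟨y, List.mem_cons_of_mem u hy, hys⟩

/-- In a chain, every element before the last has a successor. -/
theorem List.IsChain.exists_rel_of_cons_append_singleton {A : V → V → Prop} {s w : V}
    {q : List V} (h : List.IsChain A (s :: (q ++ [w]))) : ∃ y ∈ q ++ [w], A s y := by
  cases q with
  | nil => exact ⟨w, by simp, by simp_all⟩
  | cons v q => exact ⟨v, by simp, (List.isChain_cons_cons.1 h).1⟩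

/-- If X is a convex set of an acyclic digraph D and s ∈ X is a source or
a sink of D[X], then X \ {s}, if nonempty, is convex. -/
theorem convex_sdiff_singleton_of_source_or_sink {V : Type*} (A : V → V → Prop)
    (X : Set V) (s : V) (hA : DigraphAcyclic A) (hX : DigraphConvex A X) (hs : s ∈ X)
    (hss : IsSourceIn A X s ∨ IsSinkIn A X s) (hne : (X \ {s}).Nonempty) :
    DigraphConvex A (X \ {s}) := by
  refine ⟨hne, fun u w p hu hw hp x hx => ?_⟩
  have hpX := hX.2 u w p hu.1 hw.1 hp
  refine ⟨hpX x hx, ?_⟩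
  rintro rfl
  obtain ⟨p₁, p₂, rfl⟩ := List.append_of_mem hx
  have hc : List.IsChain A (u :: (p₁ ++ x :: (p₂ ++ [w]))) :=
    List.append_assoc p₁ (x :: p₂) [w] ▸ hp.1
  rcases hss with hsource | hsink
  · obtain ⟨y, hy, hyx⟩ := hc.exists_rel_of_cons_append_cons
    refine hsource y ?_ hyx
    rcases List.mem_cons.1 hy with rfl | hy
    · exact hu.1
    · exact hpX y (List.mem_append_left _ hy)
  · obtain ⟨y, hy, hxy⟩ :=
      (hc.suffix (l₁ := x :: (p₂ ++ [w])) ⟨u :: p₁, by simp⟩).exists_rel_of_cons_append_singleton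
    refine hsink y ?_ hxy
    rcases List.mem_append.1 hy with hy | hy
    · exact hpX y (by simp [hy])
    · rw [List.mem_singleton.1 hy]
      exact hw.1
end

section
/- Let D be a transitive acyclic digraph, let X and Y be disjoint sets of vertices of D such that X is a connected convex set and X ∪ Y is convex. Suppose A = N⁺(X) ∩ Y is nonempty, let v be a vertex of A having no out-neighbor in A, and let R = {v} ∪ (N⁻(v) ∩ A). Then X ∪ R is a connected convex set of D. -/
variable {V : Type*}

/-- The out-neighbourhood N⁺(X) of a set X of vertices. -/
def outNbhd (A : V → V → Prop) (X : Set V) : Set V :=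
  {y | (∃ x ∈ X, A x y) ∧ y ∉ X}

theorem DigraphConvex.mem_of_between {V : Type*} {A : V → V → Prop} (hac : DigraphAcyclic A)
    (htrans : ∀ x y z : V, A x y → A y z → A x z) {S : Set V} (hS : DigraphConvex A S)
    {u x w : V} (hu : u ∈ S) (hw : w ∈ S) (hux : A u x) (hxw : A x w) : x ∈ S := by
  have ne : ∀ {a b : V}, A a b → a ≠ b := by
    rintro a b hab rfl
    exact hac a (.single hab)
  refine hS.2 u w [x] hu hw ⟨?_, ?_⟩ x (by simp)
  · exact (by simp [hux, hxw] : List.IsChain A [u, x, w])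
  · simp [ne hux, ne hxw, ne (htrans _ _ _ hux hxw)]

theorem IsPathFromTo.arc_arc_of_mem {V : Type*} {A : V → V → Prop}
    (htrans : ∀ x y z : V, A x y → A y z → A x z) {u w : V} {p : List V}
    (h : IsPathFromTo A u p w) {x : V} (hx : x ∈ p) : A u x ∧ A x w := by
  have : IsTrans V A := ⟨htrans⟩
  have hp : (u :: (p ++ [w])).Pairwise A := List.isChain_iff_pairwise.1 h.1
  rw [List.pairwise_cons, List.pairwise_append] at hp
  exact ⟨hp.1 x (by simp [hx]), hp.2.2.2 x hx w (by simp)⟩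

theorem digraphConvex_of_between {V : Type*} {A : V → V → Prop}
    (htrans : ∀ x y z : V, A x y → A y z → A x z) {S : Set V} (hne : S.Nonempty)
    (h : ∀ u x w : V, u ∈ S → w ∈ S → A u x → A x w → x ∈ S) : DigraphConvex A S :=
  ⟨hne, fun u w _ hu hw hp x hx =>
    h u x w hu hw (hp.arc_arc_of_mem htrans hx).1 (hp.arc_arc_of_mem htrans hx).2⟩

theorem DigraphConnectedSet.union_of_subset_outNbhd {V : Type*} {A : V → V → Prop} {X R : Set V}
    (hX : DigraphConnectedSet A X) (hR : R ⊆ outNbhd A X) : DigraphConnectedSet A (X ∪ R) := by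
  refine ⟨hX.1.mono Set.subset_union_left, fun x hx y hy => ?_⟩
  let E : V → V → Prop := fun a b => a ∈ X ∪ R ∧ b ∈ X ∪ R ∧ (A a b ∨ A b a)
  have near : ∀ z ∈ X ∪ R, ∃ z' ∈ X, Relation.ReflTransGen E z z' ∧
      Relation.ReflTransGen E z' z := by
    rintro z (hz | hz)
    · exact ⟨z, hz, .refl, .refl⟩
    · obtain ⟨⟨z', hz', hA⟩, -⟩ := hR hz
      exact ⟨z', hz', .single ⟨.inr hz, .inl hz', .inr hA⟩, .single ⟨.inl hz', .inr hz, .inl hA⟩⟩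
  obtain ⟨x', hx', hxx', -⟩ := near x hx
  obtain ⟨y', hy', -, hyy'⟩ := near y hy
  have hxy : Relation.ReflTransGen E x' y' :=
    Relation.ReflTransGen.mono (fun a b hab => ⟨.inl hab.1, .inl hab.2.1, hab.2.2⟩) _ _
      (hX.2 x' hx' y' hy')
  exact (hxx'.trans hxy).trans hyy'

/-- Let D be a transitive acyclic digraph, X, Y disjoint vertex sets with
X connected convex and X ∪ Y convex. If A = N⁺(X) ∩ Y is nonempty, v ∈ A has no
out-neighbour in A, and R = {v} ∪ (N⁻(v) ∩ A), then X ∪ R is connected convex. -/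
theorem cc_union_R {V : Type*} (Arc : V → V → Prop)
    (hac : DigraphAcyclic Arc) (htrans : ∀ x y z : V, Arc x y → Arc y z → Arc x z)
    (X Y : Set V) (hdisj : Disjoint X Y)
    (hX : DigraphCC Arc X) (hXY : DigraphConvex Arc (X ∪ Y))
    (v : V) (hv : v ∈ outNbhd Arc X ∩ Y)
    (hvmax : ∀ y ∈ outNbhd Arc X ∩ Y, ¬ Arc v y)
    (R : Set V) (hR : R = {v} ∪ ({r | Arc r v} ∩ (outNbhd Arc X ∩ Y))) :
    DigraphCC Arc (X ∪ R) := by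
  have hRA : R ⊆ outNbhd Arc X ∩ Y := by
    rw [hR]
    rintro r (rfl | hr)
    exacts [hv, hr.2]
  refine ⟨hX.1.union_of_subset_outNbhd fun r hr => (hRA hr).1,
    digraphConvex_of_between htrans (hX.1.1.mono Set.subset_union_left) ?_⟩
  intro u x w hu hw hux hxw
  have hsub : X ∪ R ⊆ X ∪ Y := Set.union_subset_union_right X fun r hr => (hRA hr).2
  by_cases hxX : x ∈ X
  · exact .inl hxX
  have hxY : x ∈ Y :=
    (hXY.mem_of_between hac htrans (hsub hu) (hsub hw) hux hxw).resolve_left hxX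
  obtain ⟨x₀, hx₀, hx₀x⟩ : ∃ x₀ ∈ X, Arc x₀ x := by
    rcases hu with hu | hu
    · exact ⟨u, hu, hux⟩
    · obtain ⟨⟨x₀, hx₀, h⟩, -⟩ := (hRA hu).1
      exact ⟨x₀, hx₀, htrans _ _ _ h hux⟩
  rcases hw with hw | hw
  · exact absurd (hX.2.mem_of_between hac htrans hx₀ hw hx₀x hxw) hxX
  have hxv : Arc x v := by
    rw [hR] at hw
    rcases hw with rfl | hw
    exacts [hxw, htrans _ _ _ hxw hw.1]
  rw [hR]
  exact .inr (.inr ⟨hxv, ⟨⟨x₀, hx₀, hx₀x⟩, hxX⟩, hxY⟩)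
end

section
/- For every connected acyclic digraph D of order n, the sum of the cardinalities of all convex sets of D is at least n(n+1)/2. -/
variable {V : Type*}

/-- A set closed under in-neighbours contains every walk that ends in it. -/
theorem List.IsChain.mem_of_lowerClosed {A : V → V → Prop} {S : Set V}
    (hS : ∀ a b, A a b → b ∈ S → a ∈ S) {w : V} (hw : w ∈ S) (p : List V) :
    ∀ u, List.IsChain A (u :: (p ++ [w])) → ∀ x ∈ u :: p, x ∈ S := by
  induction p with
  | nil =>
    intro u h x hx
    simp only [List.nil_append, List.isChain_cons_cons] at h
    rw [List.mem_singleton.1 hx]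
    exact hS _ _ h.1 hw
  | cons a p ih =>
    intro u h x hx
    rw [List.cons_append, List.isChain_cons_cons] at h
    have hp := ih a h.2
    rcases List.mem_cons.1 hx with rfl | hx
    · exact hS _ _ h.1 (hp a List.mem_cons_self)
    · exact hp x hx

theorem DigraphConvex.of_lowerClosed {A : V → V → Prop} {S : Set V} (hne : S.Nonempty)
    (hS : ∀ a b, A a b → b ∈ S → a ∈ S) : DigraphConvex A S :=
  ⟨hne, fun u _ p _ hw hp x hx =>
    List.IsChain.mem_of_lowerClosed hS hw p u hp.1 x (List.mem_cons_of_mem u hx)⟩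

theorem DigraphAcyclic.wellFounded [Finite V] {A : V → V → Prop} (hA : DigraphAcyclic A) :
    WellFounded A := by
  have : Std.Irrefl (Relation.TransGen A) := ⟨hA⟩
  exact Subrelation.wf Relation.TransGen.single
    (Finite.wellFounded_of_trans_of_irrefl (Relation.TransGen A))

/-- A finite acyclic digraph has sets of every size that are closed under in-neighbours. -/
theorem DigraphAcyclic.exists_lowerClosed_card_eq [Fintype V] {A : V → V → Prop}
    (hA : DigraphAcyclic A) (k : ℕ) (hk : k ≤ Fintype.card V) :
    ∃ S : Finset V, S.card = k ∧ ∀ a b, A a b → b ∈ S → a ∈ S := by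
  classical
  induction k with
  | zero => exact ⟨∅, by simp⟩
  | succ k ih =>
    obtain ⟨S, rfl, hS⟩ := ih (by omega)
    obtain ⟨y, hy⟩ : ∃ y, y ∉ S := by
      by_contra! h
      rw [Finset.eq_univ_iff_forall.2 h, Finset.card_univ] at hk
      omega
    obtain ⟨m, hm, hmin⟩ := hA.wellFounded.has_min {x | x ∉ S} ⟨y, hy⟩
    refine ⟨insert m S, Finset.card_insert_of_notMem hm, fun a b hab hb => ?_⟩
    rcases Finset.mem_insert.1 hb with rfl | hb
    · by_contra ha
      exact hmin a (fun h => ha (Finset.mem_insert_of_mem h)) hab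
    · exact Finset.mem_insert_of_mem (hS a b hab hb)

open Classical in
/-- For every connected acyclic digraph of order n, the sum of the sizes
of all convex sets is at least n(n+1)/2. -/
theorem sum_card_convex_ge {V : Type*} [Fintype V] (A : V → V → Prop) (n : ℕ)
    (hn : Fintype.card V = n) (hA : DigraphAcyclic A) (hconn : DigraphConnected A) :
    ∑ S ∈ Finset.univ.filter (fun S : Finset V => DigraphConvex A (↑S : Set V)),
      S.card ≥ n * (n + 1) / 2 := by
  subst hn
  choose! S hcard hlower using hA.exists_lowerClosed_card_eq
  set N := Fintype.card V
  have hmem : ∀ k ∈ Finset.range (N + 1), k ≤ N := fun k hk => by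
    simpa [Nat.lt_succ_iff] using hk
  have hinj : Set.InjOn S (Finset.range (N + 1)) := fun i hi j hj h => by
    rw [← hcard i (hmem i hi), ← hcard j (hmem j hj), h]
  calc N * (N + 1) / 2 = ∑ k ∈ Finset.range (N + 1), k := by
        rw [Finset.sum_range_id, Nat.add_sub_cancel, mul_comm]
    _ = ∑ T ∈ (Finset.range (N + 1)).image S, T.card := by
        rw [Finset.sum_image hinj]
        exact Finset.sum_congr rfl fun k hk => (hcard k (hmem k hk)).symm
    _ ≤ _ := by
        refine Finset.sum_le_sum_of_ne_zero fun T hT hne => ?_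
        obtain ⟨k, hk, rfl⟩ := Finset.mem_image.1 hT
        refine Finset.mem_filter.2 ⟨Finset.mem_univ _, .of_lowerClosed ?_ ?_⟩
        · exact Finset.coe_nonempty.2 (Finset.card_ne_zero.1 hne)
        · exact hlower k (hmem k hk)
end
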